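/- Let N ≥ 1, u : T_N^d → (0,1), and let ν be the product measure on X_N with ν(η_x = 1) = u_x. Let c_x : X_N → [0,∞) be flip rates admitting the decomposition c_x(η) = c_x⁺(η)(1 − η_x) + c_x⁻(η)η_x, where c_x⁺ and c_x⁻ do not depend on the coordinate η_x. Then the function L_G^{*,ν}𝟙 on X_N equals η ↦ Σ_{x ∈ T_N^d} ( c_x⁺(η)/u_x − c_x⁻(η)/(1 − u_x) ) η̄_x, where η̄_x := η_x − u_x. -/

import Mathlib

namespace GK

open Finset

noncomputable section

/-- Occupation value of a site as a real number. -/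
def bval (b : Bool) : ℝ := if b then 1 else 0

/-- Bernoulli weight with mean `ρ`. -/
def bern (ρ : ℝ) (b : Bool) : ℝ := if b then ρ else 1 - ρ

/-- Compressibility. -/
def chi (ρ : ℝ) : ℝ := ρ * (1 - ρ)

/-- The `i`-th unit vector of `ℤ^d`. -/
def zvec (d : ℕ) (i : Fin d) : Fin d → ℤ := Pi.single i 1

/-- A function on `{0,1}^{ℤ^d}` depends only on the coordinates in `S`. -/
def IsLocal {d : ℕ} (S : Finset (Fin d → ℤ)) (h : ((Fin d → ℤ) → Bool) → ℝ) : Prop :=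
  ∀ η η' : (Fin d → ℤ) → Bool, (∀ x ∈ S, η x = η' x) → h η = h η'

/-- Expectation under the Bernoulli product measure with mean `ρ`
of a function depending only on the coordinates in `S`. -/
def bExp {d : ℕ} (ρ : ℝ) (S : Finset (Fin d → ℤ)) (h : ((Fin d → ℤ) → Bool) → ℝ) : ℝ :=
  ∑ ζ : {x // x ∈ S} → Bool,
    (∏ x : {x // x ∈ S}, bern ρ (ζ x)) *
      h fun z => if hz : z ∈ S then ζ ⟨z, hz⟩ else false

/-- Exchange of the values at `x` and `y` (lattice version). -/
def exchL {d : ℕ} (η : (Fin d → ℤ) → Bool) (x y : Fin d → ℤ) : (Fin d → ℤ) → Bool :=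
  Function.update (Function.update η x (η y)) y (η x)

/-- Translation by `x`. -/
def transl {d : ℕ} (x : Fin d → ℤ) (η : (Fin d → ℤ) → Bool) : (Fin d → ℤ) → Bool :=
  fun z => η (z + x)

/-- Discrete torus. -/
abbrev Tor (d N : ℕ) := Fin d → ZMod N

/-- Configuration space on the torus. -/
abbrev Conf (d N : ℕ) := Tor d N → Bool

/-- Unit vector on torus. -/
def uvec (d N : ℕ) (i : Fin d) : Tor d N := Pi.single i 1

/-- Exchange of values at `x,y`. -/
def exchT {d N : ℕ} (η : Conf d N) (x y : Tor d N) : Conf d N :=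
  Function.update (Function.update η x (η y)) y (η x)

/-- Flip value at `x`. -/
def flipT {d N : ℕ} (η : Conf d N) (x : Tor d N) : Conf d N :=
  Function.update η x (!(η x))

/-- Cast a lattice vector to the torus. -/
def castT (d N : ℕ) (z : Fin d → ℤ) : Tor d N := fun j => (z j : ZMod N)

/-- Configuration observed around torus point `x`, as a lattice configuration. -/
def obs {d N : ℕ} (η : Conf d N) (x : Tor d N) : (Fin d → ℤ) → Bool :=
  fun z => η (x + castT d N z)

/-- Sum over ordered nearest-neighbour pairs `(x,y)`, `|x-y|=1`. -/
def nnSum (d N : ℕ) [NeZero N] (F : Tor d N → Tor d N → ℝ) : ℝ :=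
  ∑ x : Tor d N, ∑ i : Fin d, (F x (x + uvec d N i) + F x (x - uvec d N i))

/-- Kawasaki generator with exchange rates `cc`. -/
def LK (d N : ℕ) [NeZero N] (cc : Tor d N → Tor d N → Conf d N → ℝ)
    (f : Conf d N → ℝ) (η : Conf d N) : ℝ :=
  (1/2) * ∑ x : Tor d N, ∑ i : Fin d,
    (cc x (x + uvec d N i) η * (f (exchT η x (x + uvec d N i)) - f η)
      + cc x (x - uvec d N i) η * (f (exchT η x (x - uvec d N i)) - f η))

/-- Glauber generator with flip rates `cG`. -/
def LG (d N : ℕ) [NeZero N] (cG : Tor d N → Conf d N → ℝ)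
    (f : Conf d N → ℝ) (η : Conf d N) : ℝ :=
  ∑ x : Tor d N, cG x η * (f (flipT η x) - f η)

/-- Product (Bernoulli) measure with means `u`. -/
def prodM (d N : ℕ) [NeZero N] (u : Tor d N → ℝ) (η : Conf d N) : ℝ :=
  ∏ x : Tor d N, bern (u x) (η x)

/-- Relative entropy. -/
def relEnt {d N : ℕ} [NeZero N] (μ ν : Conf d N → ℝ) : ℝ :=
  ∑ η : Conf d N, μ η * Real.log (μ η / ν η)

/-- Box `[-ℓ,ℓ]^d` in `ℤ^d`. -/
def box (d ℓ : ℕ) : Finset (Fin d → ℤ) :=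
  Fintype.piFinset fun _ => Finset.Icc (-(ℓ:ℤ)) (ℓ:ℤ)

/-- `ℓ`-ball (sup-norm box) around `z` in the torus. -/
def ball (d N : ℕ) (ℓ : ℕ) (z : Tor d N) : Finset (Tor d N) :=
  (box d ℓ).image fun w => z + castT d N w

/-- Block average of a configuration around `x`. -/
def avg (d N : ℕ) (ℓ : ℕ) (x : Tor d N) (η : Conf d N) : ℝ :=
  (1 / (2*(ℓ:ℝ)+1)^d) * ∑ w ∈ box d ℓ, bval (η (x + castT d N w))

open scoped Classical in
/-- Conditional expectation of `F` given the block average `avg` around `x`, under the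
Bernoulli(1/2) product measure. -/
def condExpUnif (d N : ℕ) [NeZero N] (ℓ : ℕ) (x : Tor d N)
    (F : Conf d N → ℝ) (η : Conf d N) : ℝ :=
  (∑ η' : Conf d N, if avg d N ℓ x η' = avg d N ℓ x η
      then F η' * prodM d N (fun _ => (1:ℝ)/2) η' else 0)
    / ∑ η' : Conf d N, if avg d N ℓ x η' = avg d N ℓ x η
        then prodM d N (fun _ => (1:ℝ)/2) η' else 0

/-- The full generator `N² L_K + K L_G` built from translation-invariant lattice rates
`cK i = c_{0,e_i}` and flip rate `cG = c_0`. -/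
def LNgen (d N : ℕ) [NeZero N] (Ksc : ℝ)
    (cK : Fin d → ((Fin d → ℤ) → Bool) → ℝ)
    (cG : ((Fin d → ℤ) → Bool) → ℝ)
    (f : Conf d N → ℝ) (η : Conf d N) : ℝ :=
  (N:ℝ)^2 * ((1/2) * ∑ x : Tor d N, ∑ i : Fin d,
      (cK i (obs η x) * (f (exchT η x (x + uvec d N i)) - f η)
        + cK i (obs η (x - uvec d N i)) * (f (exchT η x (x - uvec d N i)) - f η)))
    + Ksc * ∑ x : Tor d N, cG (obs η x) * (f (flipT η x) - f η)


theorem flipT_flipT {d N : ℕ} (η : Conf d N) (x : Tor d N) : flipT (flipT η x) x = η := by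
  simp [flipT]

theorem sum_comp_flipT {d N : ℕ} [NeZero N] (x : Tor d N) (F : Conf d N → ℝ) :
    ∑ η : Conf d N, F (flipT η x) = ∑ η : Conf d N, F η :=
  Equiv.sum_comp
    (Function.Involutive.toPerm (fun η : Conf d N => flipT η x) fun η => flipT_flipT η x) F

theorem prodM_pos {d N : ℕ} [NeZero N] {u : Tor d N → ℝ}
    (hu : ∀ x, u x ∈ Set.Ioo (0 : ℝ) 1) (η : Conf d N) : 0 < prodM d N u η := by
  refine Finset.prod_pos fun x _ => ?_
  have h0 := (hu x).1
  have h1 := (hu x).2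
  unfold bern
  split_ifs <;> linarith

theorem prodM_update {d N : ℕ} [NeZero N] (u : Tor d N → ℝ) (η : Conf d N) (x : Tor d N)
    (b : Bool) :
    prodM d N u (Function.update η x b)
      = bern (u x) b * ∏ y ∈ univ.erase x, bern (u y) (η y) := by
  unfold prodM
  rw [← Finset.mul_prod_erase univ _ (Finset.mem_univ x), Function.update_self]
  congr 1
  refine Finset.prod_congr rfl fun y hy => ?_
  rw [Function.update_of_ne (Finset.ne_of_mem_erase hy)]

/-- Action of the adjoint of a single-site flip generator on the constant function `1`. -/
theorem flip_rate_balance {d N : ℕ} [NeZero N] {u : Tor d N → ℝ}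
    (hu : ∀ x, u x ∈ Set.Ioo (0 : ℝ) 1) {c p m : Conf d N → ℝ} {x : Tor d N}
    (hc : ∀ η, c η = p η * (1 - bval (η x)) + m η * bval (η x))
    (hp : ∀ (η : Conf d N) (b : Bool), p (Function.update η x b) = p η)
    (hm : ∀ (η : Conf d N) (b : Bool), m (Function.update η x b) = m η) (η : Conf d N) :
    c (flipT η x) * prodM d N u (flipT η x) - c η * prodM d N u η
      = (p η / u x - m η / (1 - u x)) * (bval (η x) - u x) * prodM d N u η := by
  have h0 : u x ≠ 0 := (hu x).1.ne'
  have h1 : 1 - u x ≠ 0 := (sub_pos.2 (hu x).2).ne'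
  have hη : prodM d N u η = bern (u x) (η x) * ∏ y ∈ univ.erase x, bern (u y) (η y) := by
    simpa using prodM_update u η x (η x)
  rw [hη, hc, hc]
  unfold flipT
  rw [prodM_update, hp, hm, Function.update_self]
  cases η x <;> simp [bval, bern] <;> field_simp <;> ring

theorem sum_LG_mul_prodM {d N : ℕ} [NeZero N] {u : Tor d N → ℝ}
    (hu : ∀ x, u x ∈ Set.Ioo (0 : ℝ) 1) {cG cp cm : Tor d N → Conf d N → ℝ}
    (hdecomp : ∀ x η, cG x η = cp x η * (1 - bval (η x)) + cm x η * bval (η x))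
    (hcp : ∀ (x : Tor d N) (η : Conf d N) (b : Bool), cp x (Function.update η x b) = cp x η)
    (hcm : ∀ (x : Tor d N) (η : Conf d N) (b : Bool), cm x (Function.update η x b) = cm x η)
    (f : Conf d N → ℝ) :
    ∑ η : Conf d N, LG d N cG f η * prodM d N u η
      = ∑ η : Conf d N, (∑ x : Tor d N,
          (cp x η / u x - cm x η / (1 - u x)) * (bval (η x) - u x)) * f η * prodM d N u η := by
  simp only [LG, Finset.sum_mul]
  rw [Finset.sum_comm, Finset.sum_comm (s := (univ : Finset (Conf d N)))]
  refine Finset.sum_congr rfl fun x _ => ?_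
  have hflip := sum_comp_flipT x
    fun η => cG x (flipT η x) * f η * prodM d N u (flipT η x)
  simp only [flipT_flipT] at hflip
  calc
    _ = ∑ η : Conf d N, cG x η * f (flipT η x) * prodM d N u η
        - ∑ η : Conf d N, cG x η * f η * prodM d N u η := by
      rw [← Finset.sum_sub_distrib]
      exact Finset.sum_congr rfl fun η _ => by ring
    _ = _ := by
      rw [hflip, ← Finset.sum_sub_distrib]
      refine Finset.sum_congr rfl fun η _ => ?_
      linear_combination f η * flip_rate_balance hu (hdecomp x) (hcp x) (hcm x) η

/-- Lemma `lem:2.5FT`: computation of `L_G^{*,ν}𝟙` for the product measure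
`ν` with means `u`, for flip rates `c_x(η) = c_x⁺(η)(1-η_x) + c_x⁻(η)η_x` with `c_x^±` not
depending on `η_x`.  `g` denotes `L_G^{*,ν}𝟙`, characterized by the adjoint identity `hg`. -/
theorem stmt_8 (d N : ℕ) [NeZero N] (hN : 1 ≤ N)
    (u : Tor d N → ℝ) (hu : ∀ x, u x ∈ Set.Ioo (0:ℝ) 1)
    (cG cp cm : Tor d N → Conf d N → ℝ)
    (hcG : ∀ x η, 0 ≤ cG x η)
    (hdecomp : ∀ x η, cG x η = cp x η * (1 - bval (η x)) + cm x η * bval (η x))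
    (hcp_indep : ∀ (x : Tor d N) (η : Conf d N) (b : Bool),
      cp x (Function.update η x b) = cp x η)
    (hcm_indep : ∀ (x : Tor d N) (η : Conf d N) (b : Bool),
      cm x (Function.update η x b) = cm x η)
    (g : Conf d N → ℝ)
    (hg : ∀ f : Conf d N → ℝ,
      ∑ η : Conf d N, LG d N cG f η * prodM d N u η
        = ∑ η : Conf d N, g η * f η * prodM d N u η) :
    ∀ η : Conf d N,
      g η = ∑ x : Tor d N,
        (cp x η / u x - cm x η / (1 - u x)) * (bval (η x) - u x) := by
  intro η
  have h := hg (Pi.single η 1)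
  rw [sum_LG_mul_prodM hu hdecomp hcp_indep hcm_indep] at h
  simp only [Pi.single_apply, mul_ite, mul_one, mul_zero, ite_mul, zero_mul,
    Finset.sum_ite_eq', Finset.mem_univ, if_true] at h
  exact (mul_right_cancel₀ (prodM_pos hu η).ne' h).symm

end
end GK
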